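/- Let n = 2r, let U ∈ ℝ^{n×n} be nonsingular with column blocks U_1, …, U_r ∈ ℝ^{n×2} and let U⁻¹ have row blocks V_1, …, V_r ∈ ℝ^{2×n}; let θ_1, …, θ_r ∈ (0, 2π), let J_k be the 2×2 rotation matrix by angle θ_k, and set L := Σ_{k=1}^r U_k J_k V_k. Assume L has nondegenerate spectrum, i.e. the 2r numbers e^{±iθ_k}, k = 1,…,r, are pairwise distinct. Then for every real symmetric positive definite matrix Ψ ∈ ℝ^{n×n}, the limit lim_{N→∞} (1/N) Σ_{ℓ=1}^N L^{-ℓ} Ψ (L^{-ℓ})ᵀ exists and equals (1/2) Σ_{k=1}^r σ_k² U_k U_kᵀ, where σ_k := √(Tr(V_k Ψ V_kᵀ)). -/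

import Mathlib

open scoped BigOperators Matrix

lemma aux_geom (φ : ℝ) (h : Complex.exp (Complex.I * φ) ≠ 1) :
    Filter.Tendsto (fun N : ℕ => (N : ℂ)⁻¹ * ∑ ℓ ∈ Finset.range N,
      Complex.exp (Complex.I * φ) ^ (ℓ + 1)) Filter.atTop (nhds 0) := by
  set z := Complex.exp (Complex.I * φ) with hz
  have hz1 : ‖z‖ = 1 := by rw [hz, mul_comm]; exact Complex.norm_exp_ofReal_mul_I φ
  have hlim : Filter.Tendsto (fun N : ℕ => (2 / ‖z - 1‖) * (N : ℝ)⁻¹) Filter.atTop (nhds 0) := by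
    simpa using (tendsto_inv_atTop_nhds_zero_nat (𝕜 := ℝ)).const_mul (2 / ‖z - 1‖)
  refine squeeze_zero_norm (fun N => ?_) hlim
  have e : ∑ ℓ ∈ Finset.range N, z ^ (ℓ + 1) = z * ((z ^ N - 1) / (z - 1)) := by
    rw [← geom_sum_eq h, Finset.mul_sum]
    exact Finset.sum_congr rfl fun _ _ => by ring
  rw [e, norm_mul, norm_mul, norm_div, hz1, norm_inv, Complex.norm_natCast, one_mul, mul_comm]
  gcongr
  calc ‖z ^ N - 1‖ ≤ ‖z ^ N‖ + ‖(1 : ℂ)‖ := norm_sub_le _ _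
    _ = 2 := by rw [norm_pow, hz1]; norm_num

lemma aux_pow (φ : ℝ) (ℓ : ℕ) : Complex.exp (Complex.I * φ) ^ (ℓ + 1) =
    (Real.cos ((ℓ + 1 : ℝ) * φ) : ℂ) + (Real.sin ((ℓ + 1 : ℝ) * φ) : ℂ) * Complex.I := by
  rw [← Complex.exp_nat_mul, Complex.ofReal_cos, Complex.ofReal_sin, ← Complex.exp_mul_I]
  congr 1
  push_cast
  ring

/-- Cesàro convergence. -/
def Ces (f : ℕ → ℝ) (a : ℝ) : Prop :=
  Filter.Tendsto (fun N : ℕ => (N : ℝ)⁻¹ * ∑ ℓ ∈ Finset.range N, f ℓ) Filter.atTop (nhds a)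

lemma Ces.add {f g : ℕ → ℝ} {a b : ℝ} (hf : Ces f a) (hg : Ces g b) :
    Ces (fun n => f n + g n) (a + b) := by
  unfold Ces at *
  simpa [Finset.sum_add_distrib, mul_add] using Filter.Tendsto.add hf hg

lemma Ces.smul {f : ℕ → ℝ} {a : ℝ} (c : ℝ) (hf : Ces f a) :
    Ces (fun n => c * f n) (c * a) := by
  unfold Ces at *
  simpa [← Finset.mul_sum, mul_left_comm] using Filter.Tendsto.const_mul c hf

lemma Ces.one : Ces (fun _ => 1) 1 := by
  unfold Ces
  refine tendsto_const_nhds.congr' ?_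
  filter_upwards [Filter.eventually_gt_atTop 0] with N hN
  have : (N : ℝ) ≠ 0 := by positivity
  simp [this]

lemma Ces.zero : Ces (fun _ => 0) 0 := by simp [Ces]

lemma ces_cos (φ : ℝ) (h : Complex.exp (Complex.I * φ) ≠ 1) :
    Ces (fun ℓ => Real.cos ((ℓ + 1 : ℝ) * φ)) 0 := by
  have := (Complex.continuous_re.tendsto 0).comp (aux_geom φ h)
  refine this.congr fun N => ?_
  simp only [aux_pow, Function.comp]
  rw [show ((N : ℂ)⁻¹) = (((N : ℝ)⁻¹ : ℝ) : ℂ) by push_cast; rfl, Complex.re_ofReal_mul,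
    Complex.re_sum]
  congr 1
  refine Finset.sum_congr rfl fun ℓ _ => ?_
  simp [-Complex.ofReal_cos, -Complex.ofReal_sin]

lemma ces_sin (φ : ℝ) (h : Complex.exp (Complex.I * φ) ≠ 1) :
    Ces (fun ℓ => Real.sin ((ℓ + 1 : ℝ) * φ)) 0 := by
  have := (Complex.continuous_im.tendsto 0).comp (aux_geom φ h)
  refine this.congr fun N => ?_
  simp only [aux_pow, Function.comp]
  rw [show ((N : ℂ)⁻¹) = (((N : ℝ)⁻¹ : ℝ) : ℂ) by push_cast; rfl, Complex.im_ofReal_mul,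
    Complex.im_sum]
  congr 1
  refine Finset.sum_congr rfl fun ℓ _ => ?_
  simp [-Complex.ofReal_cos, -Complex.ofReal_sin]

/-- rotation block diagonal -/
noncomputable def DD {r : ℕ} (θ : Fin r → ℝ) (t : ℝ) :
    Matrix (Fin r × Fin 2) (Fin r × Fin 2) ℝ :=
  Matrix.of fun p q => if p.1 = q.1 then
    !![Real.cos (t * θ p.1), -Real.sin (t * θ p.1);
      Real.sin (t * θ p.1), Real.cos (t * θ p.1)] p.2 q.2 else 0

lemma DD_mul {r : ℕ} (θ : Fin r → ℝ) (s t : ℝ) : DD θ s * DD θ t = DD θ (s + t) := by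
  ext ⟨k, i⟩ ⟨m, j⟩
  simp only [DD, Matrix.mul_apply, Matrix.of_apply, Fintype.sum_prod_type, Fin.sum_univ_two]
  by_cases h : k = m
  · subst h
    rw [Finset.sum_eq_single k (by intro b _ hb; simp [hb.symm]) (by simp)]
    fin_cases i <;> fin_cases j <;> simp [add_mul, Real.cos_add, Real.sin_add] <;> ring
  · rw [Finset.sum_eq_zero]
    · simp [h]
    · intro x _
      by_cases hx : k = x
      · subst hx; simp [h]
      · simp [hx]

lemma DD_zero {r : ℕ} (θ : Fin r → ℝ) : DD θ 0 = 1 := by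
  ext ⟨k, i⟩ ⟨m, j⟩
  by_cases h : k = m
  · subst h
    fin_cases i <;> fin_cases j <;> simp [DD, Matrix.one_apply]
  · simp [DD, Matrix.one_apply, h]

lemma DD_pow {r : ℕ} (θ : Fin r → ℝ) (t : ℝ) (n : ℕ) : DD θ t ^ n = DD θ (n * t) := by
  induction n with
  | zero => simp [DD_zero]
  | succ n ih => rw [pow_succ, ih, DD_mul]; congr 1; push_cast; ring

lemma conj_pow_aux {ι : Type*} [Fintype ι] [DecidableEq ι] (U V D : Matrix ι ι ℝ)
    (h : V * U = 1) (h' : U * V = 1) (n : ℕ) : (U * D * V) ^ n = U * D ^ n * V := by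
  induction n with
  | zero => simp [h']
  | succ n ih =>
    rw [pow_succ, ih, pow_succ]
    calc U * D ^ n * V * (U * D * V) = U * D ^ n * (V * U) * D * V := by noncomm_ring
      _ = _ := by rw [h]; noncomm_ring

lemma ces_cc {a b : ℝ} {δ : ℝ} (h1 : Complex.exp (Complex.I * (a + b : ℝ)) ≠ 1)
    (h2 : Ces (fun ℓ => Real.cos ((ℓ + 1 : ℝ) * (a - b))) δ) :
    Ces (fun ℓ => Real.cos ((ℓ + 1 : ℝ) * a) * Real.cos ((ℓ + 1 : ℝ) * b)) (δ / 2) := by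
  have := (h2.add (ces_cos _ h1)).smul (1 / 2)
  convert this using 1
  · funext ℓ; simp only [mul_add, mul_sub, Real.cos_add, Real.cos_sub]; ring
  · ring

lemma ces_ss {a b : ℝ} {δ : ℝ} (h1 : Complex.exp (Complex.I * (a + b : ℝ)) ≠ 1)
    (h2 : Ces (fun ℓ => Real.cos ((ℓ + 1 : ℝ) * (a - b))) δ) :
    Ces (fun ℓ => Real.sin ((ℓ + 1 : ℝ) * a) * Real.sin ((ℓ + 1 : ℝ) * b)) (δ / 2) := by
  have := (h2.add ((ces_cos _ h1).smul (-1))).smul (1 / 2)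
  convert this using 1
  · funext ℓ; simp only [mul_add, mul_sub, Real.cos_add, Real.cos_sub]; ring
  · ring

lemma ces_sc {a b : ℝ} (h1 : Complex.exp (Complex.I * (a + b : ℝ)) ≠ 1)
    (h2 : Ces (fun ℓ => Real.sin ((ℓ + 1 : ℝ) * (a - b))) 0) :
    Ces (fun ℓ => Real.sin ((ℓ + 1 : ℝ) * a) * Real.cos ((ℓ + 1 : ℝ) * b)) 0 := by
  have := (h2.add (ces_sin _ h1)).smul (1 / 2)
  convert this using 1
  · funext ℓ; simp only [mul_add, mul_sub, Real.sin_add, Real.sin_sub]; ring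
  · ring

lemma ces_cs {a b : ℝ} (h1 : Complex.exp (Complex.I * (a + b : ℝ)) ≠ 1)
    (h2 : Ces (fun ℓ => Real.sin ((ℓ + 1 : ℝ) * (a - b))) 0) :
    Ces (fun ℓ => Real.cos ((ℓ + 1 : ℝ) * a) * Real.sin ((ℓ + 1 : ℝ) * b)) 0 := by
  have := ((h2.smul (-1)).add (ces_sin _ h1)).smul (1 / 2)
  convert this using 1
  · funext ℓ; simp only [mul_add, mul_sub, Real.sin_add, Real.sin_sub]; ring
  · ring

lemma entry_aux {r : ℕ} (θ : Fin r → ℝ) (W : Matrix (Fin r × Fin 2) (Fin r × Fin 2) ℝ)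
    (t : ℝ) (k m : Fin r) (i j : Fin 2) :
    (DD θ t * W * (DD θ t)ᵀ) (k, i) (m, j) =
      ∑ a, ∑ b, DD θ t (k, i) (k, a) * W (k, a) (m, b) * DD θ t (m, j) (m, b) := by
  have h1 : ∀ (X : Matrix (Fin r × Fin 2) (Fin r × Fin 2) ℝ) k i q,
      (DD θ t * X) (k, i) q = ∑ a, DD θ t (k, i) (k, a) * X (k, a) q := by
    intro X k i q
    rw [Matrix.mul_apply, Fintype.sum_prod_type, Finset.sum_eq_single k _ (by simp)]
    intro b _ hb
    exact Finset.sum_eq_zero fun x _ => by simp [DD, hb.symm]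
  rw [Matrix.mul_assoc, h1]
  refine Finset.sum_congr rfl fun a _ => ?_
  rw [← Matrix.transpose_apply (W * (DD θ t)ᵀ), Matrix.transpose_mul, Matrix.transpose_transpose,
    h1, Finset.mul_sum]
  refine Finset.sum_congr rfl fun b _ => ?_
  rw [Matrix.transpose_apply]; ring

lemma core {r : ℕ} (θ : Fin r → ℝ) (hp : ∀ k m, Complex.exp (Complex.I * (θ k + θ m : ℝ)) ≠ 1)
    (hm : ∀ k m, k ≠ m → Complex.exp (Complex.I * (θ k - θ m : ℝ)) ≠ 1)
    (W : Matrix (Fin r × Fin 2) (Fin r × Fin 2) ℝ) (hW : Wᵀ = W) :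
    Filter.Tendsto (fun N : ℕ => (N : ℝ)⁻¹ •
        ∑ ℓ ∈ Finset.range N, DD θ (-(ℓ + 1 : ℝ)) * W * (DD θ (-(ℓ + 1 : ℝ)))ᵀ)
      Filter.atTop (nhds (Matrix.diagonal fun p : Fin r × Fin 2 =>
        (W (p.1, 0) (p.1, 0) + W (p.1, 1) (p.1, 1)) / 2)) := by
  refine tendsto_pi_nhds.2 ?_; rintro ⟨k, i⟩
  refine tendsto_pi_nhds.2 ?_; rintro ⟨m, j⟩
  simp only [Matrix.smul_apply, Matrix.sum_apply, smul_eq_mul, entry_aux]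
  change Ces _ _
  have hc : Ces (fun ℓ => Real.cos ((ℓ + 1 : ℝ) * (θ k - θ m))) (if k = m then 1 else 0) := by
    split_ifs with h
    · subst h; simpa using Ces.one
    · exact ces_cos _ (hm k m h)
  have hs : Ces (fun ℓ => Real.sin ((ℓ + 1 : ℝ) * (θ k - θ m))) 0 := by
    by_cases h : k = m
    · subst h; simpa using Ces.zero
    · exact ces_sin _ (hm k m h)
  have cc := ces_cc (hp k m) hc
  have ss := ces_ss (hp k m) hc
  have cs := ces_cs (hp k m) hs
  have sc := ces_sc (hp k m) hs
  have hsym : k = m → W (k, 1) (m, 0) = W (k, 0) (m, 1) := by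
    rintro rfl
    conv_lhs => rw [← hW]
    rfl
  have key : ∀ x y z w : ℝ, Ces (fun ℓ : ℕ =>
      x * (Real.cos ((ℓ + 1 : ℝ) * θ k) * Real.cos ((ℓ + 1 : ℝ) * θ m)) +
      y * (Real.sin ((ℓ + 1 : ℝ) * θ k) * Real.sin ((ℓ + 1 : ℝ) * θ m)) +
      z * (Real.cos ((ℓ + 1 : ℝ) * θ k) * Real.sin ((ℓ + 1 : ℝ) * θ m)) +
      w * (Real.sin ((ℓ + 1 : ℝ) * θ k) * Real.cos ((ℓ + 1 : ℝ) * θ m)))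
      ((x + y) * ((if k = m then 1 else 0) / 2)) := by
    intro x y z w
    convert (((cc.smul x).add (ss.smul y)).add (cs.smul z)).add (sc.smul w) using 1
    ring
  have fin : ∀ (x y z w : ℝ) (f : ℕ → ℝ) (c : ℝ), (∀ ℓ : ℕ, f ℓ = 
      x * (Real.cos ((ℓ + 1 : ℝ) * θ k) * Real.cos ((ℓ + 1 : ℝ) * θ m)) +
      y * (Real.sin ((ℓ + 1 : ℝ) * θ k) * Real.sin ((ℓ + 1 : ℝ) * θ m)) +
      z * (Real.cos ((ℓ + 1 : ℝ) * θ k) * Real.sin ((ℓ + 1 : ℝ) * θ m)) +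
      w * (Real.sin ((ℓ + 1 : ℝ) * θ k) * Real.cos ((ℓ + 1 : ℝ) * θ m))) →
      c = ((x + y) * ((if k = m then 1 else 0) / 2)) → Ces f c := by
    intro x y z w f c hf hc
    rw [hc, funext hf]; exact key x y z w
  have ev : ∀ (t : ℝ) (k : Fin r) (i a : Fin 2), DD θ (-t) (k, i) (k, a) =
      !![Real.cos (t * θ k), Real.sin (t * θ k); -Real.sin (t * θ k), Real.cos (t * θ k)] i a := by
    intro t k i a
    fin_cases i <;> fin_cases a <;> simp [DD]
  simp only [ev, Fin.sum_univ_two]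
  fin_cases i <;> fin_cases j
  · refine fin (W (k, 0) (m, 0)) (W (k, 1) (m, 1)) (W (k, 0) (m, 1)) (W (k, 1) (m, 0)) _ _ ?_ ?_
    · intro ℓ; simp; ring
    · by_cases h : k = m
      · subst h; simp; ring
      · simp [h]
  · refine fin (W (k, 0) (m, 1)) (-W (k, 1) (m, 0)) (-W (k, 0) (m, 0)) (W (k, 1) (m, 1)) _ _ ?_ ?_
    · intro ℓ; simp; ring
    · by_cases h : k = m
      · rw [hsym h]; simp
      · simp [h]
  · refine fin (W (k, 1) (m, 0)) (-W (k, 0) (m, 1)) (W (k, 1) (m, 1)) (-W (k, 0) (m, 0)) _ _ ?_ ?_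
    · intro ℓ; simp; ring
    · by_cases h : k = m
      · rw [hsym h]; simp
      · simp [h]
  · refine fin (W (k, 1) (m, 1)) (W (k, 0) (m, 0)) (-W (k, 1) (m, 0)) (-W (k, 0) (m, 1)) _ _ ?_ ?_
    · intro ℓ; simp; ring
    · by_cases h : k = m
      · subst h; simp; ring
      · simp [h]


/-- for `L = Σ_k U_k J_k V_k` similar to an orthogonal matrix with
nondegenerate spectrum `{e^{±iθ_k}}` and any symmetric positive definite `Ψ`, the
Cesàro averages `(1/N) Σ_{ℓ=1}^N L^{-ℓ} Ψ (L^{-ℓ})ᵀ` converge to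
`(1/2) Σ_k σ_k² U_k U_kᵀ` with `σ_k = √Tr(V_k Ψ V_kᵀ)`. -/
theorem stmt17 (r : ℕ) (hr : 0 < r)
    (U : Matrix (Fin r × Fin 2) (Fin r × Fin 2) ℝ) (hU : IsUnit U.det)
    (θ : Fin r → ℝ) (hθ : ∀ k, θ k ∈ Set.Ioo 0 (2 * Real.pi))
    (hspec : Function.Injective fun p : Fin r × Bool =>
      Complex.exp (Complex.I * (if p.2 then (θ p.1 : ℂ) else -(θ p.1 : ℂ))))
    (L : Matrix (Fin r × Fin 2) (Fin r × Fin 2) ℝ)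
    (hL : L = ∑ k : Fin r,
      (Matrix.of fun i (j : Fin 2) => U i (k, j)) *
        !![Real.cos (θ k), -Real.sin (θ k); Real.sin (θ k), Real.cos (θ k)] *
        (Matrix.of fun (i : Fin 2) j => U⁻¹ (k, i) j))
    (Ψ : Matrix (Fin r × Fin 2) (Fin r × Fin 2) ℝ) (hΨ : Ψ.PosDef) :
    Filter.Tendsto
      (fun N : ℕ => (N : ℝ)⁻¹ •
        ∑ ℓ ∈ Finset.range N, L⁻¹ ^ (ℓ + 1) * Ψ * (L⁻¹ ^ (ℓ + 1))ᵀ)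
      Filter.atTop
      (nhds ((1 / 2 : ℝ) • ∑ k : Fin r,
        (Real.sqrt (((Matrix.of fun (i : Fin 2) j => U⁻¹ (k, i) j) * Ψ *
            (Matrix.of fun (i : Fin 2) j => U⁻¹ (k, i) j)ᵀ).trace)) ^ 2 •
          ((Matrix.of fun i (j : Fin 2) => U i (k, j)) *
            (Matrix.of fun i (j : Fin 2) => U i (k, j))ᵀ))) := by
  have hVU : U⁻¹ * U = 1 := Matrix.nonsing_inv_mul U hU
  have hUV : U * U⁻¹ = 1 := Matrix.mul_nonsing_inv U hU
  have hp : ∀ k m, Complex.exp (Complex.I * (θ k + θ m : ℝ)) ≠ 1 := by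
    intro k m h
    have := @hspec (k, true) (m, false) (by
      simp only [if_true, Bool.false_eq_true, if_false]
      rw [show Complex.I * (θ k : ℂ) = Complex.I * (θ k + θ m : ℝ) + Complex.I * -(θ m : ℂ) by
        push_cast; ring, Complex.exp_add, h, one_mul])
    simp at this
  have hm : ∀ k m, k ≠ m → Complex.exp (Complex.I * (θ k - θ m : ℝ)) ≠ 1 := by
    intro k m hkm h
    have := @hspec (k, true) (m, true) (by
      simp only [if_true]
      rw [show Complex.I * (θ k : ℂ) = Complex.I * (θ k - θ m : ℝ) + Complex.I * (θ m : ℂ) by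
        push_cast; ring, Complex.exp_add, h, one_mul])
    exact hkm (by simpa using this)
  have hLD : L = U * DD θ 1 * U⁻¹ := by
    rw [hL]
    ext p q
    have h1 : ∀ (k : Fin r) (b : Fin 2), (U * DD θ 1) p (k, b) =
        ∑ a, U p (k, a) * DD θ 1 (k, a) (k, b) := by
      intro k b
      rw [Matrix.mul_apply, Fintype.sum_prod_type, Finset.sum_eq_single k _ (by simp)]
      intro x _ hx
      exact Finset.sum_eq_zero fun y _ => by simp [DD, hx]
    rw [Matrix.sum_apply, Matrix.mul_apply, Fintype.sum_prod_type]
    refine Finset.sum_congr rfl fun k _ => ?_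
    simp only [h1]
    simp [Matrix.mul_apply, DD, Fin.sum_univ_two]
  have hLi : L⁻¹ = U * DD θ (-1) * U⁻¹ := by
    apply Matrix.inv_eq_right_inv
    rw [hLD]
    calc U * DD θ 1 * U⁻¹ * (U * DD θ (-1) * U⁻¹)
        = U * DD θ 1 * (U⁻¹ * U) * DD θ (-1) * U⁻¹ := by noncomm_ring
      _ = U * (DD θ 1 * DD θ (-1)) * U⁻¹ := by rw [hVU]; noncomm_ring
      _ = 1 := by rw [DD_mul]; simp [DD_zero, hUV]
  have hΨs : Ψᵀ = Ψ := by simpa using hΨ.isHermitian.eq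
  have hcore := core θ hp hm (U⁻¹ * Ψ * U⁻¹ᵀ) (by
    simp [Matrix.transpose_mul, hΨs, Matrix.mul_assoc])
  have hcont : Continuous fun X : Matrix (Fin r × Fin 2) (Fin r × Fin 2) ℝ => U * X * Uᵀ := by
    fun_prop
  have := (hcont.tendsto _).comp hcore
  convert this using 1
  · funext N
    simp only [Function.comp, Matrix.mul_smul, Matrix.smul_mul, Matrix.mul_sum, Matrix.sum_mul]
    congr 1
    refine Finset.sum_congr rfl fun ℓ _ => ?_
    rw [hLi, conj_pow_aux _ _ _ hVU hUV, DD_pow]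
    have : ((ℓ + 1 : ℕ) : ℝ) * (-1) = -(ℓ + 1 : ℝ) := by push_cast; ring
    rw [this]
    simp only [Matrix.transpose_mul, Matrix.mul_assoc]
  · congr 1
    have hk : ∀ k : Fin r, (Real.sqrt (((Matrix.of fun (i : Fin 2) j => U⁻¹ (k, i) j) * Ψ *
            (Matrix.of fun (i : Fin 2) j => U⁻¹ (k, i) j)ᵀ).trace)) ^ 2 =
        (U⁻¹ * Ψ * U⁻¹ᵀ) (k, 0) (k, 0) + (U⁻¹ * Ψ * U⁻¹ᵀ) (k, 1) (k, 1) := by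
      intro k
      rw [Real.sq_sqrt]
      · simp [Matrix.trace, Fin.sum_univ_two, Matrix.mul_apply]
      · have h := (hΨ.posSemidef.mul_mul_conjTranspose_same
          (Matrix.of fun (i : Fin 2) j => U⁻¹ (k, i) j)).trace_nonneg
        simpa [Matrix.conjTranspose_eq_transpose_of_trivial] using h
    simp only [hk]
    ext p q
    rw [Matrix.smul_apply, Matrix.sum_apply, Matrix.mul_apply (M := U * _), Fintype.sum_prod_type,
      Finset.smul_sum]
    refine Finset.sum_congr rfl fun k _ => ?_
    simp only [Matrix.smul_apply, Matrix.mul_apply (M := Matrix.of _), Matrix.mul_diagonal,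
      Fin.sum_univ_two, Matrix.transpose_apply, Matrix.of_apply, smul_eq_mul]
    ring
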